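/- Consider the $L_\infty$ approximation problem ${\rm APP} = \{{\rm APP}_{\infty,d}\}_{d \in \mathbb{N}}$ over the Korobov spaces with exponential weight $H(K_{d,\mathbf{a},\mathbf{b}})$ in the worst case setting, for either information class $\Lambda \in \{\Lambda^{\rm std}, \Lambda^{\rm all}\}$ and either error criterion $\star \in \{{\rm ABS}, {\rm NOR}\}$. Then ${\rm APP}$ is exponentially uniformly weakly tractable if and only if $\lim_{j \to \infty} \frac{\ln a_j}{\ln j} = \infty$. -/

import Mathlib

open Filter
open scoped ENNReal NNReal

noncomputable section

/-- Coefficient space: `ℓ²` sequences indexed by `ℤ^d`.  An element `u` represents the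
function `f ∈ H^ω(𝕋^d)` with Fourier coefficients `f̂(k) = u k / ω k`, so that
`‖u‖_{ℓ²} = ‖f‖_{H^ω}`. -/
abbrev Coef (d : ℕ) := lp (fun _ : Fin d → ℤ => ℂ) 2

/-- The periodic function represented by the coefficients `u`:
`f(x) = ∑_{k ∈ ℤ^d} (u k / ω k) e^{2πi k·x}`. -/
def torusFn {d : ℕ} (ω : (Fin d → ℤ) → ℝ) (u : Coef d) (x : Fin d → ℝ) : ℂ :=
  ∑' k : Fin d → ℤ,
    ((ω k : ℂ))⁻¹ * u k * Complex.exp (2 * Real.pi * Complex.I * ∑ j, (k j : ℂ) * (x j : ℂ))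

/-- The torus `𝕋^d`, modelled as the cube `[0,1]^d`. -/
def cube (d : ℕ) : Set (Fin d → ℝ) := {x | ∀ j, x j ∈ Set.Icc (0 : ℝ) 1}

/-- Standard information: point-evaluation functionals `f ↦ f(x)`. -/
def stdInfo {d : ℕ} (ω : (Fin d → ℤ) → ℝ) : Set (Coef d → ℂ) :=
  {L | ∃ x ∈ cube d, L = fun u => torusFn ω u x}

/-- General linear information: all continuous linear functionals on `H^ω`. -/
def allInfo (d : ℕ) : Set (Coef d → ℂ) := {L | ∃ T : Coef d →L[ℂ] ℂ, L = ⇑T}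

/-- The `n`-th minimal worst case error `e(n, APP_{∞,d}; Λ)` of `L_∞`-approximation on the
unit ball of `H^ω(𝕋^d)`, using algorithms `f ↦ φ(L₁ f, …, Lₙ f)` with `Lᵢ ∈ Λ`. -/
def wcErr {d : ℕ} (ω : (Fin d → ℤ) → ℝ) (Λ : Set (Coef d → ℂ)) (n : ℕ) : ℝ≥0∞ :=
  ⨅ (L : Fin n → Coef d → ℂ) (_ : ∀ i, L i ∈ Λ) (φ : (Fin n → ℂ) → (Fin d → ℝ) → ℂ),
    ⨆ (u : Coef d) (_ : ‖u‖ ≤ 1) (x : Fin d → ℝ) (_ : x ∈ cube d),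
      (‖torusFn ω u x - φ (fun i => L i u) x‖₊ : ℝ≥0∞)

/-- The initial error `e(0, APP_{∞,d}) = sup_{‖f‖_{H^ω} ≤ 1} ‖f‖_∞`. -/
def initErr {d : ℕ} (ω : (Fin d → ℤ) → ℝ) : ℝ≥0∞ :=
  ⨆ (u : Coef d) (_ : ‖u‖ ≤ 1) (x : Fin d → ℝ) (_ : x ∈ cube d),
    (‖torusFn ω u x‖₊ : ℝ≥0∞)

/-- The error criterion: absolute (ABS) or normalized (NOR). -/
inductive Crit | ABS | NOR

/-- `CRI_d`: the normalizing quantity of the error criterion. -/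
def CRI {d : ℕ} (ω : (Fin d → ℤ) → ℝ) : Crit → ℝ≥0∞
  | Crit.ABS => 1
  | Crit.NOR => initErr ω

/-- The information complexity `n^⋆(ε, d; Λ)`. -/
def infoComp {d : ℕ} (ω : (Fin d → ℤ) → ℝ) (Λ : Set (Coef d → ℂ)) (crit : Crit) (ε : ℝ) : ℕ :=
  sInf {n : ℕ | wcErr ω Λ n ≤ ENNReal.ofReal ε * CRI ω crit}

/-- Algebraic strong polynomial tractability of the family of information complexities `nc`. -/
def ALGSPT (nc : ℕ → ℝ → ℕ) : Prop :=
  ∃ C > (0:ℝ), ∃ p ≥ (0:ℝ), ∀ d : ℕ, 0 < d → ∀ ε ∈ Set.Ioo (0:ℝ) 1,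
    (nc d ε : ℝ) ≤ C * ε ^ (-p)

/-- The exponent of algebraic strong polynomial tractability. -/
def ALGSPTexp (nc : ℕ → ℝ → ℕ) : ℝ :=
  sInf {p : ℝ | 0 ≤ p ∧ ∃ C > (0:ℝ), ∀ d : ℕ, 0 < d → ∀ ε ∈ Set.Ioo (0:ℝ) 1,
    (nc d ε : ℝ) ≤ C * ε ^ (-p)}

/-- Algebraic polynomial tractability. -/
def ALGPT (nc : ℕ → ℝ → ℕ) : Prop :=
  ∃ C > (0:ℝ), ∃ p ≥ (0:ℝ), ∃ q ≥ (0:ℝ), ∀ d : ℕ, 0 < d → ∀ ε ∈ Set.Ioo (0:ℝ) 1,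
    (nc d ε : ℝ) ≤ C * (d : ℝ) ^ q * ε ^ (-p)

/-- Algebraic quasi-polynomial tractability. -/
def ALGQPT (nc : ℕ → ℝ → ℕ) : Prop :=
  ∃ C > (0:ℝ), ∃ t ≥ (0:ℝ), ∀ d : ℕ, 0 < d → ∀ ε ∈ Set.Ioo (0:ℝ) 1,
    (nc d ε : ℝ) ≤ C * Real.exp (t * (1 + Real.log d) * (1 + Real.log ε⁻¹))

/-- The exponent of algebraic quasi-polynomial tractability. -/
def ALGQPTexp (nc : ℕ → ℝ → ℕ) : ℝ :=
  sInf {t : ℝ | 0 ≤ t ∧ ∃ C > (0:ℝ), ∀ d : ℕ, 0 < d → ∀ ε ∈ Set.Ioo (0:ℝ) 1,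
    (nc d ε : ℝ) ≤ C * Real.exp (t * (1 + Real.log d) * (1 + Real.log ε⁻¹))}

/-- Exponential quasi-polynomial tractability. -/
def EXPQPT (nc : ℕ → ℝ → ℕ) : Prop :=
  ∃ C > (0:ℝ), ∃ t ≥ (0:ℝ), ∀ d : ℕ, 0 < d → ∀ ε ∈ Set.Ioo (0:ℝ) 1,
    (nc d ε : ℝ) ≤ C * Real.exp (t * (1 + Real.log d) * (1 + Real.log (Real.log ε⁻¹ + 1)))

/-- The exponent of exponential quasi-polynomial tractability. -/
def EXPQPTexp (nc : ℕ → ℝ → ℕ) : ℝ :=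
  sInf {t : ℝ | 0 ≤ t ∧ ∃ C > (0:ℝ), ∀ d : ℕ, 0 < d → ∀ ε ∈ Set.Ioo (0:ℝ) 1,
    (nc d ε : ℝ) ≤ C * Real.exp (t * (1 + Real.log d) * (1 + Real.log (Real.log ε⁻¹ + 1)))}

/-- `lim_{ε⁻¹ + d → ∞} (log nc(d, ε)) / den(d, ε) = 0`. -/
def WTlim (den : ℕ → ℝ → ℝ) (nc : ℕ → ℝ → ℕ) : Prop :=
  ∀ δ > (0:ℝ), ∃ M : ℝ, ∀ d : ℕ, 0 < d → ∀ ε ∈ Set.Ioo (0:ℝ) 1,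
    M ≤ ε⁻¹ + d → |Real.log (nc d ε) / den d ε| < δ

/-- Algebraic `(s,t)`-weak tractability; `ALGWTst 1 1` is algebraic weak tractability. -/
def ALGWTst (s t : ℝ) (nc : ℕ → ℝ → ℕ) : Prop :=
  WTlim (fun d ε => ε ^ (-s) + (d : ℝ) ^ t) nc

/-- Algebraic uniform weak tractability. -/
def ALGUWT (nc : ℕ → ℝ → ℕ) : Prop := ∀ α > (0:ℝ), ∀ β > (0:ℝ), ALGWTst α β nc

/-- Exponential `(s,t)`-weak tractability; `EXPWTst 1 1` is exponential weak tractability. -/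
def EXPWTst (s t : ℝ) (nc : ℕ → ℝ → ℕ) : Prop :=
  WTlim (fun d ε => (1 + Real.log ε⁻¹) ^ s + (d : ℝ) ^ t) nc

/-- Exponential uniform weak tractability. -/
def EXPUWT (nc : ℕ → ℝ → ℕ) : Prop := ∀ α > (0:ℝ), ∀ β > (0:ℝ), EXPWTst α β nc

/-- The weight of the Korobov space with exponential weight `H(K_{d,a,b})`:
`ω_d(h) = ω_h^{-1/2}` where `ω_h = ω^{∑_k a_k |h_k|^{b_k}}` (coordinate `k` uses
`a_{k+1}, b_{k+1}`, the sequences being indexed starting from `1`). -/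
def expKorWeight (w : ℝ) (a b : ℕ → ℝ) (d : ℕ) (h : Fin d → ℤ) : ℝ :=
  w ^ (-(∑ j : Fin d, a (j.1 + 1) * (|h j| : ℝ) ^ b (j.1 + 1)) / 2)

/-- The information complexity function of `L_∞`-approximation over the Korobov spaces
with exponential weight, for `Λ^std` (`useStd = true`) or `Λ^all` (`useStd = false`). -/
def expKorNC (w : ℝ) (a b : ℕ → ℝ) (useStd : Bool) (crit : Crit) : ℕ → ℝ → ℕ := fun d ε =>
  infoComp (expKorWeight w a b d) (if useStd then stdInfo (expKorWeight w a b d) else allInfo d)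
    crit ε

/-- The character `e_k`. -/
def chr {d : ℕ} (k : Fin d → ℤ) (x : Fin d → ℝ) : ℂ :=
  Complex.exp (2 * Real.pi * Complex.I * ∑ j, (k j : ℂ) * (x j : ℂ))

lemma norm_chr {d : ℕ} (k : Fin d → ℤ) (x : Fin d → ℝ) : ‖chr k x‖ = 1 := by
  have : chr k x = Complex.exp (((2 * Real.pi * ∑ j, (k j : ℝ) * x j : ℝ) : ℂ) * Complex.I) := by
    unfold chr; congr 1; push_cast; ring
  rw [this, Complex.norm_exp_ofReal_mul_I]

lemma chr_prod {d : ℕ} (k : Fin d → ℤ) (x : Fin d → ℝ) :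
    chr k x = ∏ j, Complex.exp (2 * Real.pi * Complex.I * ((k j : ℂ) * (x j : ℂ))) := by
  unfold chr; rw [Finset.mul_sum, Complex.exp_sum]

lemma torusFn_eq {d : ℕ} (ω : (Fin d → ℤ) → ℝ) (u : Coef d) (x : Fin d → ℝ) :
    torusFn ω u x = ∑' k, ((ω k : ℂ))⁻¹ * u k * chr k x := rfl

lemma coef_summable {d : ℕ} (u : Coef d) : Summable (fun k => ‖u k‖ ^ 2) := by
  have := (lp.memℓp u).summable (by norm_num)
  simpa using this

lemma coef_norm {d : ℕ} (u : Coef d) : (∑' k, ‖u k‖ ^ 2) = ‖u‖ ^ 2 := by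
  have := lp.norm_rpow_eq_tsum (p := 2) (by norm_num) u
  simpa using this.symm

/-- Cauchy-Schwarz bound. -/
lemma cs_bound {d : ℕ} (g : (Fin d → ℤ) → ℝ) (hg : ∀ k, 0 ≤ g k) (S : ℝ)
    (hS : ∀ s : Finset (Fin d → ℤ), ∑ k ∈ s, g k ^ 2 ≤ S) (u : Coef d) :
    Summable (fun k => g k * ‖u k‖) ∧ ∑' k, g k * ‖u k‖ ≤ √S * ‖u‖ := by
  have hs : Summable (fun k => g k ^ 2) := summable_of_sum_le (fun k => sq_nonneg _) hS
  have h2 : (2:ℝ).HolderConjugate 2 := Real.HolderConjugate.two_two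
  have hle : ∑' k, g k ^ 2 ≤ S := hs.tsum_le_of_sum_le hS
  have h1 := Real.summable_mul_of_Lp_Lq_of_nonneg h2 hg (fun k => norm_nonneg (u k))
    (by simpa using hs) (by simpa using coef_summable u)
  have h := Real.inner_le_Lp_mul_Lq_tsum_of_nonneg h2 hg (fun k => norm_nonneg (u k))
    (by simpa using hs) (by simpa using coef_summable u)
  refine ⟨h1, h.trans ?_⟩
  simp only [Real.rpow_two, coef_norm, ← Real.sqrt_eq_rpow]
  rw [Real.sqrt_sq (norm_nonneg _)]
  gcongr

lemma norm_term {d : ℕ} (ω : (Fin d → ℤ) → ℝ) (hω : ∀ k, 0 < ω k) (u : Coef d) (x : Fin d → ℝ)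
    (k : Fin d → ℤ) :
    ‖((ω k : ℂ))⁻¹ * u k * chr k x‖ = (ω k)⁻¹ * ‖u k‖ := by
  simp [norm_chr, abs_of_pos (hω k)]

section generic
variable {d : ℕ} (ω : (Fin d → ℤ) → ℝ) (hω : ∀ k, 0 < ω k) (S : ℝ)
    (hS : ∀ s : Finset (Fin d → ℤ), ∑ k ∈ s, (ω k)⁻¹ ^ 2 ≤ S)
include hω hS

lemma torus_summable (u : Coef d) (x : Fin d → ℝ) :
    Summable (fun k => ((ω k : ℂ))⁻¹ * u k * chr k x) := by
  apply Summable.of_norm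
  simp only [norm_term ω hω]
  exact (cs_bound _ (fun k => (inv_pos.2 (hω k)).le) S hS u).1

lemma torus_le (u : Coef d) (x : Fin d → ℝ) : ‖torusFn ω u x‖ ≤ √S * ‖u‖ := by
  rw [torusFn_eq]
  have h := (cs_bound _ (fun k => (inv_pos.2 (hω k)).le) S hS u)
  refine (norm_tsum_le_tsum_norm ?_).trans ?_
  · simp only [norm_term ω hω]; exact h.1
  · simp only [norm_term ω hω]; exact h.2

lemma exists_eval (x : Fin d → ℝ) : ∃ T : Coef d →L[ℂ] ℂ, ∀ u, T u = torusFn ω u x := by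
  let l : Coef d →ₗ[ℂ] ℂ :=
    { toFun := fun u => torusFn ω u x
      map_add' := by
        intro u v
        simp only [torusFn_eq]
        rw [← (torus_summable ω hω S hS u x).tsum_add (torus_summable ω hω S hS v x)]
        congr 1; ext k
        simp only [lp.coeFn_add, Pi.add_apply]; ring
      map_smul' := by
        intro c u
        simp only [torusFn_eq, RingHom.id_apply, smul_eq_mul]
        rw [← tsum_mul_left]
        congr 1; ext k
        simp only [lp.coeFn_smul, Pi.smul_apply, smul_eq_mul]; ring }
  exact ⟨l.mkContinuous (√S) (fun u => torus_le ω hω S hS u x), fun u => rfl⟩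

lemma std_subset : stdInfo ω ⊆ allInfo d := by
  rintro L ⟨x, hx, rfl⟩
  obtain ⟨T, hT⟩ := exists_eval ω hω S hS x
  exact ⟨T, by ext u; exact (hT u).symm⟩

lemma initErr_le : initErr ω ≤ ENNReal.ofReal √S := by
  unfold initErr
  refine iSup_le fun u => iSup_le fun hu => iSup_le fun x => iSup_le fun hx => ?_
  rw [← enorm_eq_nnnorm, ← ofReal_norm]
  apply ENNReal.ofReal_le_ofReal
  refine (torus_le ω hω S hS u x).trans ?_
  nlinarith [Real.sqrt_nonneg S]

end generic

lemma wcErr_anti {d : ℕ} (ω : (Fin d → ℤ) → ℝ) {Λ Λ' : Set (Coef d → ℂ)} (h : Λ ⊆ Λ') (n : ℕ) :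
    wcErr ω Λ' n ≤ wcErr ω Λ n := by
  unfold wcErr
  refine le_iInf fun L => le_iInf fun hL => ?_
  exact iInf_le_of_le L (iInf_le_of_le (fun i => h (hL i)) le_rfl)

lemma torus_single {d : ℕ} (ω : (Fin d → ℤ) → ℝ) (h : Fin d → ℤ) (x : Fin d → ℝ) :
    torusFn ω (lp.single 2 h (1:ℂ)) x = ((ω h : ℂ))⁻¹ * chr h x := by
  rw [torusFn_eq, tsum_eq_single h]
  · simp
  · intro k hk
    simp [lp.single_apply, hk]

lemma one_le_initErr {d : ℕ} (ω : (Fin d → ℤ) → ℝ) (h0 : ω 0 = 1) : 1 ≤ initErr ω := by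
  unfold initErr
  refine le_iSup_of_le (lp.single 2 0 (1:ℂ)) (le_iSup_of_le ?_
    (le_iSup_of_le 0 (le_iSup_of_le ?_ ?_)))
  · rw [lp.norm_single (by norm_num)]; simp
  · intro j; simp
  · rw [torus_single, h0]; simp [chr]

lemma geom_root (N : ℕ) (hN : 0 < N) (t : ℤ) :
    ∑ g : Fin N, Complex.exp (2 * Real.pi * Complex.I * ((t : ℂ) * (((g : ℕ) / N : ℝ) : ℂ)))
      = if (N : ℤ) ∣ t then (N : ℂ) else 0 := by
  have hN0 : (N : ℂ) ≠ 0 := by exact_mod_cast hN.ne'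
  have hI : (2 * (Real.pi : ℂ) * Complex.I) ≠ 0 := Complex.two_pi_I_ne_zero
  set z : ℂ := Complex.exp (2 * Real.pi * Complex.I * (t / N)) with hz
  have h1 : ∀ g : Fin N, Complex.exp (2 * Real.pi * Complex.I *
      ((t : ℂ) * (((g : ℕ) / N : ℝ) : ℂ))) = z ^ (g : ℕ) := by
    intro g
    rw [hz, ← Complex.exp_nat_mul]; congr 1; push_cast; ring
  have hz1 : z = 1 ↔ (N : ℤ) ∣ t := by
    rw [hz, Complex.exp_eq_one_iff]
    constructor
    · rintro ⟨n, hn⟩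
      refine ⟨n, ?_⟩
      have : (t : ℂ) / N = n := by
        apply mul_left_cancel₀ hI; rw [hn]; ring
      rw [div_eq_iff hN0] at this
      have h2 : ((t : ℤ) : ℂ) = ((N * n : ℤ) : ℂ) := by rw [this]; push_cast; ring
      exact_mod_cast h2
    · rintro ⟨n, rfl⟩
      refine ⟨n, ?_⟩
      push_cast; field_simp
  have hzN : z ^ N = 1 := by
    rw [hz, ← Complex.exp_nat_mul, Complex.exp_eq_one_iff]
    exact ⟨t, by field_simp⟩
  rw [Finset.sum_congr rfl (fun g _ => h1 g), Fin.sum_univ_eq_sum_range (fun g => z ^ g)]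
  split_ifs with h
  · rw [hz1.2 h]; simp
  · have hne : z ≠ 1 := fun hh => h (hz1.1 hh)
    rw [geom_sum_eq hne, hzN]; simp

lemma interp1 (m : ℕ) : ∃ D : Fin (2 * m + 1) → ℝ → ℂ, ∀ h : ℤ, ∃ r : ℤ,
    (|h| ≤ m → r = h) ∧ ∀ x : ℝ,
      ∑ g : Fin (2 * m + 1), Complex.exp (2 * Real.pi * Complex.I *
        ((h : ℂ) * (((g : ℕ) / (2 * m + 1 : ℕ) : ℝ) : ℂ))) * D g x
      = Complex.exp (2 * Real.pi * Complex.I * ((r : ℂ) * (x : ℂ))) := by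
  refine ⟨fun g x => ((2 * m + 1 : ℕ) : ℂ)⁻¹ * ∑ k ∈ Finset.Icc (-(m : ℤ)) m,
    Complex.exp (2 * Real.pi * Complex.I * ((k : ℂ) * (x : ℂ))) *
     Complex.exp (-(2 * Real.pi * Complex.I * ((k : ℂ) * (((g : ℕ) / (2 * m + 1 : ℕ) : ℝ) : ℂ)))),
    fun h => ⟨(h + m) % (2 * m + 1 : ℕ) - m, ?_, fun x => ?_⟩⟩
  · intro hh
    rw [abs_le] at hh
    rw [Int.emod_eq_of_lt (by omega) (by push_cast; omega)]; ring
  set r : ℤ := (h + m) % (2 * m + 1 : ℕ) - m with hr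
  have hN0 : ((2 * m + 1 : ℕ) : ℂ) ≠ 0 := by exact_mod_cast (Nat.succ_ne_zero (2 * m))
  have hrange : r ∈ Finset.Icc (-(m : ℤ)) m := by
    have h1 := Int.emod_nonneg (h + m) (b := ((2 * m + 1 : ℕ) : ℤ)) (by positivity)
    have h2 := Int.emod_lt_of_pos (h + m) (b := ((2 * m + 1 : ℕ) : ℤ)) (by positivity)
    rw [Finset.mem_Icc]; push_cast at *; omega
  have hdvd : (((2 * m + 1 : ℕ) : ℤ)) ∣ h - r := by
    have := Int.emod_add_mul_ediv (h + m) ((2 * m + 1 : ℕ) : ℤ)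
    refine ⟨(h + m) / ((2 * m + 1 : ℕ) : ℤ), ?_⟩
    rw [hr]; linarith
  have huniq : ∀ k ∈ Finset.Icc (-(m : ℤ)) m, k ≠ r → ¬ (((2 * m + 1 : ℕ) : ℤ)) ∣ h - k := by
    intro k hk hkr hd
    have hd2 : (((2 * m + 1 : ℕ) : ℤ)) ∣ k - r := by
      have h5 : k - r = (h - r) - (h - k) := by omega
      rw [h5]; exact dvd_sub hdvd hd
    rw [Finset.mem_Icc] at hk hrange
    have := Int.eq_zero_of_abs_lt_dvd hd2 (by rw [abs_lt]; push_cast; constructor <;> omega)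
    omega
  calc _ = ∑ k ∈ Finset.Icc (-(m : ℤ)) m, ((2 * m + 1 : ℕ) : ℂ)⁻¹ *
        Complex.exp (2 * Real.pi * Complex.I * ((k : ℂ) * (x : ℂ))) *
        ∑ g : Fin (2 * m + 1), Complex.exp (2 * Real.pi * Complex.I *
          (((h - k : ℤ) : ℂ) * (((g : ℕ) / (2 * m + 1 : ℕ) : ℝ) : ℂ))) := by
        simp only [Finset.mul_sum]
        rw [Finset.sum_comm]
        refine Finset.sum_congr rfl fun k _ => Finset.sum_congr rfl fun g _ => ?_
        have : Complex.exp (2 * Real.pi * Complex.I *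
          (((h - k : ℤ) : ℂ) * (((g : ℕ) / (2 * m + 1 : ℕ) : ℝ) : ℂ))) =
          Complex.exp (2 * Real.pi * Complex.I *
        ((h : ℂ) * (((g : ℕ) / (2 * m + 1 : ℕ) : ℝ) : ℂ))) *
          Complex.exp (-(2 * Real.pi * Complex.I *
            ((k : ℂ) * (((g : ℕ) / (2 * m + 1 : ℕ) : ℝ) : ℂ)))) := by
          rw [← Complex.exp_add]; congr 1; push_cast; ring
        rw [this]; ring
    _ = _ := by
        simp only [geom_root (2 * m + 1) (Nat.succ_pos _)]
        rw [Finset.sum_eq_single r]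
        · rw [if_pos hdvd]; field_simp
        · intro k hk hkr
          rw [if_neg (huniq k hk hkr)]; ring
        · intro hh; exact absurd hrange hh

lemma interpd {d : ℕ} (m : Fin d → ℕ) : ∃ (D : (∀ j, Fin (2 * m j + 1)) → (Fin d → ℝ) → ℂ)
    (pt : (∀ j, Fin (2 * m j + 1)) → (Fin d → ℝ)), (∀ g, pt g ∈ cube d) ∧
    ∀ h : Fin d → ℤ, ∃ r : Fin d → ℤ, ((∀ j, |h j| ≤ m j) → r = h) ∧
      ∀ x, ∑ g, chr h (pt g) * D g x = chr r x := by
  choose D r hr1 hr2 using fun j => interp1 (m j)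
  refine ⟨fun g x => ∏ j, D j (g j) (x j), fun g j => ((g j : ℕ) / (2 * m j + 1 : ℕ) : ℝ), ?_, ?_⟩
  · intro g j
    have h1 := (g j).2
    constructor
    · positivity
    · rw [div_le_one (by positivity)]; exact_mod_cast h1.le
  · intro h
    refine ⟨fun j => r j (h j), fun hh => funext fun j => hr1 j (h j) (hh j), fun x => ?_⟩
    simp only [chr_prod, ← Finset.prod_mul_distrib]
    rw [← Finset.prod_congr rfl (fun j _ => hr2 j (h j) (x j)), Finset.prod_univ_sum,
      Fintype.piFinset_univ]

lemma wcErr_upper {d : ℕ} (ω : (Fin d → ℤ) → ℝ) (hω : ∀ k, 0 < ω k) (S : ℝ)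
    (hS : ∀ s : Finset (Fin d → ℤ), ∑ k ∈ s, (ω k)⁻¹ ^ 2 ≤ S) (m : Fin d → ℕ) (R : ℝ)
    (hR : ∀ s : Finset (Fin d → ℤ),
      ∑ k ∈ s, (if ∀ j, |k j| ≤ m j then 0 else (ω k)⁻¹) ^ 2 ≤ R) :
    wcErr ω (stdInfo ω) (∏ j, (2 * m j + 1)) ≤ ENNReal.ofReal (2 * √R) := by
  obtain ⟨D, pt, hpt, hD⟩ := interpd m
  choose r hr1 hr2 using hD
  have hcard : Fintype.card (∀ j, Fin (2 * m j + 1)) = ∏ j, (2 * m j + 1) := by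
    simp [Fintype.card_pi]
  let e : (∀ j, Fin (2 * m j + 1)) ≃ Fin (∏ j, (2 * m j + 1)) := Fintype.equivFinOfCardEq hcard
  unfold wcErr
  refine iInf_le_of_le (fun i u => torusFn ω u (pt (e.symm i))) (iInf_le_of_le ?_ (iInf_le_of_le
    (fun y x => ∑ g, y (e g) * D g x) ?_))
  · intro i; exact ⟨_, hpt _, rfl⟩
  refine iSup_le fun u => iSup_le fun hu => iSup_le fun x => iSup_le fun hx => ?_
  rw [← enorm_eq_nnnorm, ← ofReal_norm]
  apply ENNReal.ofReal_le_ofReal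
  simp only [Equiv.symm_apply_apply]
  have hsum := fun x => torus_summable ω hω S hS u x
  have h1 : ∑ g, torusFn ω u (pt g) * D g x = ∑' k, ((ω k : ℂ))⁻¹ * u k * chr (r k) x := by
    simp only [torusFn_eq, ← tsum_mul_right]
    rw [← Summable.tsum_finsetSum (fun g _ => (hsum (pt g)).mul_right _)]
    congr 1; ext k
    rw [← hr2 k x, Finset.mul_sum]
    exact Finset.sum_congr rfl fun g _ => by ring
  have hcs := cs_bound (fun k => if ∀ j, |k j| ≤ m j then 0 else (ω k)⁻¹)
    (fun k => by split_ifs <;> [exact le_rfl; exact (inv_pos.2 (hω k)).le]) R hR u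
  have hsum2 : Summable (fun k => ((ω k : ℂ))⁻¹ * u k * chr (r k) x) := by
    apply Summable.of_norm
    have := (hsum x).norm
    simpa only [norm_mul, norm_chr] using this
  have hle : ∀ k, ‖((ω k : ℂ))⁻¹ * u k * chr k x - ((ω k : ℂ))⁻¹ * u k * chr (r k) x‖ ≤
      2 * ((if ∀ j, |k j| ≤ m j then 0 else (ω k)⁻¹) * ‖u k‖) := by
    intro k
    split_ifs with hk
    · rw [hr1 k hk]; simp
    · refine (norm_sub_le _ _).trans ?_
      simp only [norm_mul, norm_chr, norm_inv, Complex.norm_real, Real.norm_eq_abs,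
        abs_of_pos (hω k)]
      linarith
  rw [h1, torusFn_eq, ← (hsum x).tsum_sub hsum2]
  refine (tsum_of_norm_bounded (hcs.1.mul_left 2).hasSum hle).trans ?_
  rw [tsum_mul_left]
  have := hcs.2
  nlinarith [Real.sqrt_nonneg R]

lemma orth {d : ℕ} (q q' : Fin d → Fin 2) :
    ∑ y : Fin d → Fin 2, chr (fun j => (((q j : ℕ) : ℤ) - ((q' j : ℕ) : ℤ)))
      (fun j => (((y j : ℕ) : ℝ) / (2 : ℕ))) = if q = q' then (2 : ℂ) ^ d else 0 := by
  simp only [chr_prod]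
  have := Finset.prod_univ_sum (fun _ : Fin d => (Finset.univ : Finset (Fin 2)))
    (fun j (t : Fin 2) => Complex.exp (2 * Real.pi * Complex.I *
      (((((q j : ℕ) : ℤ) - ((q' j : ℕ) : ℤ) : ℤ) : ℂ) * (((t : ℕ) / (2 : ℕ) : ℝ) : ℂ))))
  rw [Fintype.piFinset_univ] at this
  rw [← this]
  simp only [geom_root 2 two_pos]
  split_ifs with h
  · subst h; simp
  · obtain ⟨j, hj⟩ := Function.ne_iff.1 h
    apply Finset.prod_eq_zero (Finset.mem_univ j)
    rw [if_neg]
    have h1 := (q j).2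
    have h2 := (q' j).2
    have h3 : (q j : ℕ) ≠ q' j := fun hh => hj (Fin.ext hh)
    push_cast
    omega

/-- Integer vector of a 0/1 vector. -/
def zv {d : ℕ} (q : Fin d → Fin 2) : Fin d → ℤ := fun j => ((q j : ℕ) : ℤ)

lemma wcErr_lower {d : ℕ} (ω : (Fin d → ℤ) → ℝ) (hω : ∀ k, 0 < ω k) (S : ℝ)
    (hS : ∀ s : Finset (Fin d → ℤ), ∑ k ∈ s, (ω k)⁻¹ ^ 2 ≤ S) (n : ℕ) (hn : n < 2 ^ d)
    (η : ℝ) (hη : ∀ q : Fin d → Fin 2, η ≤ (ω (zv q))⁻¹) :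
    ENNReal.ofReal (η / 2 ^ d) ≤ wcErr ω (allInfo d) n := by
  unfold wcErr
  refine le_iInf fun L => le_iInf fun hL => le_iInf fun φ => ?_
  choose T hT using hL
  let E : ((Fin d → Fin 2) → ℂ) →ₗ[ℂ] Coef d :=
    ∑ q, (LinearMap.proj (R := ℂ) (φ := fun _ : Fin d → Fin 2 => ℂ) q).smulRight
      (lp.single 2 (zv q) (1:ℂ))
  have hE : ∀ c, E c = ∑ q, c q • (lp.single 2 (zv q) (1:ℂ) : Coef d) := by
    intro c; simp [E]
  let F : ((Fin d → Fin 2) → ℂ) →ₗ[ℂ] (Fin n → ℂ) :=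
    LinearMap.pi fun i => (T i).toLinearMap ∘ₗ E
  have hker : LinearMap.ker F ≠ ⊥ := by
    apply LinearMap.ker_ne_bot_of_finrank_lt
    simpa using hn
  obtain ⟨c0, hc0, hc0n⟩ := (Submodule.ne_bot_iff _).1 hker
  obtain ⟨q, -, hq⟩ := Finset.exists_max_image Finset.univ (fun q => ‖c0 q‖)
    ⟨fun _ => 0, Finset.mem_univ _⟩
  have hq0 : 0 < ‖c0 q‖ := by
    obtain ⟨p, hp⟩ := Function.ne_iff.1 hc0n
    exact (norm_pos_iff.2 hp).trans_le (hq p (Finset.mem_univ _))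
  let c : (Fin d → Fin 2) → ℂ := ((2 ^ d * ‖c0 q‖ : ℝ) : ℂ)⁻¹ • c0
  have hcF : F c = 0 := by
    simp only [c, map_smul]; rw [LinearMap.mem_ker.1 hc0, smul_zero]
  have hcn : ∀ p, ‖c p‖ = (2 ^ d * ‖c0 q‖)⁻¹ * ‖c0 p‖ := by
    intro p
    simp [c]
  have hcq : ‖c q‖ = (2 ^ d)⁻¹ := by rw [hcn]; field_simp
  have hcp : ∀ p, ‖c p‖ ≤ (2 ^ d)⁻¹ := by
    intro p; rw [← hcq, hcn, hcn]
    have := hq p (Finset.mem_univ _)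
    gcongr
  set u : Coef d := E c with hu
  have hun : ‖u‖ ≤ 1 := by
    rw [hu, hE]
    refine (norm_sum_le _ _).trans ?_
    calc _ ≤ ∑ p : Fin d → Fin 2, ((2:ℝ) ^ d)⁻¹ := by
          refine Finset.sum_le_sum fun p _ => ?_
          rw [norm_smul, lp.norm_single (by norm_num)]; simpa using hcp p
      _ = 1 := by simp
  have hLu : ∀ i, L i u = 0 := by
    intro i
    rw [hT i]
    exact congrFun hcF i
  have hLnu : ∀ i, L i (-u) = 0 := by
    intro i
    have := hLu i
    rw [hT i] at this ⊢
    rw [map_neg, this, neg_zero]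
  have hf : ∀ x, torusFn ω u x = ∑ p, c p * (((ω (zv p) : ℂ))⁻¹ * chr (zv p) x) := by
    intro x
    obtain ⟨V, hV⟩ := exists_eval ω hω S hS x
    rw [← hV, hu, hE, map_sum]
    refine Finset.sum_congr rfl fun p _ => ?_
    rw [map_smul, hV, torus_single, smul_eq_mul]
  have hfn : ∀ x, torusFn ω (-u) x = - torusFn ω u x := by
    intro x
    obtain ⟨V, hV⟩ := exists_eval ω hω S hS x
    rw [← hV, ← hV, map_neg]
  let pt : (Fin d → Fin 2) → (Fin d → ℝ) := fun y j => (((y j : ℕ) : ℝ) / (2 : ℕ))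
  have hpt : ∀ y, pt y ∈ cube d := by
    intro y j
    have := (y j).2
    have h2 : ((y j : ℕ) : ℝ) ≤ 1 := by exact_mod_cast (by omega : (y j : ℕ) ≤ 1)
    constructor
    · simp only [pt]; positivity
    · simp only [pt]; push_cast; linarith
  -- recover coefficient
  have hrec : ∑ y, torusFn ω u (pt y) * chr (-zv q) (pt y) =
      2 ^ d * (c q * ((ω (zv q) : ℂ))⁻¹) := by
    simp only [hf, Finset.sum_mul]
    rw [Finset.sum_comm]
    have : ∀ p, ∑ y, c p * (((ω (zv p) : ℂ))⁻¹ * chr (zv p) (pt y)) * chr (-zv q) (pt y) =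
        c p * ((ω (zv p) : ℂ))⁻¹ * if p = q then (2 : ℂ) ^ d else 0 := by
      intro p
      rw [← orth, Finset.mul_sum]
      refine Finset.sum_congr rfl fun y _ => ?_
      have : chr (fun j => (((p j : ℕ) : ℤ) - ((q j : ℕ) : ℤ)))
          (fun j => (((y j : ℕ) : ℝ) / (2 : ℕ))) = chr (zv p) (pt y) * chr (-zv q) (pt y) := by
        unfold chr zv
        rw [← Complex.exp_add, ← mul_add, ← Finset.sum_add_distrib]
        congr 2
        refine Finset.sum_congr rfl fun j _ => ?_
        simp only [pt, Pi.neg_apply]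
        push_cast; ring
      rw [this]; ring
    simp only [this]
    simp; ring
  have hex : ∃ y, η / 2 ^ d ≤ ‖torusFn ω u (pt y)‖ := by
    by_contra! hcon
    have h1 : ‖∑ y, torusFn ω u (pt y) * chr (-zv q) (pt y)‖ < ∑ y : Fin d → Fin 2, η / 2 ^ d := by
      refine (norm_sum_le _ _).trans_lt ?_
      refine Finset.sum_lt_sum_of_nonempty ⟨fun _ => 0, Finset.mem_univ _⟩ fun y _ => ?_
      rw [norm_mul, norm_chr, mul_one]; exact hcon y
    rw [hrec] at h1
    have h2 := hη q
    simp only [norm_mul, norm_pow, hcq, norm_inv, Complex.norm_real, Real.norm_eq_abs,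
      abs_of_pos (hω _), Complex.norm_ofNat, Finset.sum_const, Finset.card_univ, Fintype.card_fun,
      Fintype.card_fin, nsmul_eq_mul] at h1
    push_cast at h1
    have h3 : (2:ℝ) ^ d * ((2 ^ d)⁻¹ * (ω (zv q))⁻¹) = (ω (zv q))⁻¹ := by field_simp
    have h4 : (2:ℝ) ^ d * (η / 2 ^ d) = η := by field_simp
    rw [h3, h4] at h1
    linarith
  obtain ⟨y, hy⟩ := hex
  have key : ∀ v : Coef d, ‖v‖ ≤ 1 → (∀ i, L i v = 0) →
      ENNReal.ofReal ‖torusFn ω v (pt y) - φ (fun _ => 0) (pt y)‖ ≤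
      ⨆ (u : Coef d) (_ : ‖u‖ ≤ 1) (x : Fin d → ℝ) (_ : x ∈ cube d),
      (‖torusFn ω u x - φ (fun i => L i u) x‖₊ : ℝ≥0∞) := by
    intro v hv hv0
    refine le_iSup_of_le v (le_iSup_of_le hv (le_iSup_of_le (pt y) (le_iSup_of_le (hpt y) ?_)))
    rw [← enorm_eq_nnnorm, ← ofReal_norm]
    simp only [hv0]; exact le_rfl
  have k1 := key u hun hLu
  have k2 := key (-u) (by rwa [norm_neg]) hLnu
  rw [hfn] at k2
  have h3 : 2 * ‖torusFn ω u (pt y)‖ ≤ ‖torusFn ω u (pt y) - φ (fun _ => 0) (pt y)‖ +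
      ‖-torusFn ω u (pt y) - φ (fun _ => 0) (pt y)‖ := by
    have := norm_sub_le (torusFn ω u (pt y) - φ (fun _ => 0) (pt y))
      (-torusFn ω u (pt y) - φ (fun _ => 0) (pt y))
    rw [show torusFn ω u (pt y) - φ (fun _ => 0) (pt y) -
      (-torusFn ω u (pt y) - φ (fun _ => 0) (pt y)) = 2 * torusFn ω u (pt y) by ring,
      norm_mul, Complex.norm_ofNat] at this
    exact this
  rcases le_total ‖torusFn ω u (pt y) - φ (fun _ => 0) (pt y)‖
    ‖-torusFn ω u (pt y) - φ (fun _ => 0) (pt y)‖ with h | h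
  · exact (ENNReal.ofReal_le_ofReal (by linarith)).trans k2
  · exact (ENNReal.ofReal_le_ofReal (by linarith)).trans k1

lemma exists_K (w : ℝ) (hw : w ∈ Set.Ioo (0:ℝ) 1) (κ c : ℝ) (hκ : 0 < κ) (hc : 0 < c) :
    ∃ K > (0:ℝ), ∀ s : Finset ℤ, ∑ h ∈ s, w ^ (κ * |(h:ℝ)| ^ c) ≤ K := by
  have hl : 0 < -Real.log w := by have := Real.log_neg hw.1 hw.2; linarith
  have hnat : Summable (fun n : ℕ => w ^ (κ * |((n:ℤ):ℝ)| ^ c)) := by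
    have h1 := isLittleO_exp_neg_mul_rpow_atTop (mul_pos hκ hl) (-(2 / c))
    have h2 : Tendsto (fun n : ℕ => (n:ℝ) ^ c) atTop atTop :=
      (tendsto_rpow_atTop hc).comp tendsto_natCast_atTop_atTop
    have h3 := (h1.comp_tendsto h2).isBigO
    refine summable_of_isBigO_nat (g := fun n : ℕ => (n:ℝ) ^ (-2:ℝ))
      (Real.summable_nat_rpow.2 (by norm_num)) ?_
    refine (h3.congr ?_ ?_)
    · intro n
      simp only [Function.comp, Int.cast_natCast, Nat.abs_cast]
      rw [Real.rpow_def_of_pos hw.1]; congr 1; ring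
    · intro n
      simp only [Function.comp]
      rw [← Real.rpow_mul (Nat.cast_nonneg n)]
      congr 1; field_simp
  have hs : Summable (fun h : ℤ => w ^ (κ * |(h:ℝ)| ^ c)) := by
    refine Summable.of_nat_of_neg (f := fun h : ℤ => w ^ (κ * |(h:ℝ)| ^ c)) hnat ?_
    refine hnat.congr fun n => ?_
    rw [Int.cast_neg, abs_neg]
  have hpos : ∀ h : ℤ, 0 ≤ w ^ (κ * |(h:ℝ)| ^ c) := fun h => Real.rpow_nonneg hw.1.le _
  refine ⟨(∑' h : ℤ, w ^ (κ * |(h:ℝ)| ^ c)) + 1, ?_, fun s => ?_⟩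
  · have : 0 ≤ ∑' h : ℤ, w ^ (κ * |(h:ℝ)| ^ c) := tsum_nonneg hpos
    linarith
  · have := hs.sum_le_tsum s (fun h _ => hpos h); linarith

lemma weight_pos {w : ℝ} (hw : w ∈ Set.Ioo (0:ℝ) 1) (a b : ℕ → ℝ) (d : ℕ) (h : Fin d → ℤ) :
    0 < expKorWeight w a b d h := Real.rpow_pos_of_pos hw.1 _

lemma weight_sq {w : ℝ} (hw : w ∈ Set.Ioo (0:ℝ) 1) (a b : ℕ → ℝ) (d : ℕ) (h : Fin d → ℤ) :
    (expKorWeight w a b d h)⁻¹ ^ 2 = ∏ j : Fin d, w ^ (a (j.1 + 1) * |(h j : ℝ)| ^ b (j.1 + 1)) := by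
  unfold expKorWeight
  rw [← Real.rpow_neg hw.1.le, ← Real.rpow_natCast, ← Real.rpow_mul hw.1.le,
    ← Real.rpow_sum_of_pos hw.1]
  congr 1; push_cast; ring

lemma prod_bound {d : ℕ} (f : Fin d → ℤ → ℝ) (hf : ∀ j h, 0 ≤ f j h) (B : Fin d → ℝ)
    (hB : ∀ j (s : Finset ℤ), ∑ h ∈ s, f j h ≤ B j) (s : Finset (Fin d → ℤ)) :
    ∑ h ∈ s, ∏ j, f j (h j) ≤ ∏ j, B j := by
  calc _ ≤ ∑ h ∈ Fintype.piFinset (fun j => s.image (fun h => h j)), ∏ j, f j (h j) := by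
        refine Finset.sum_le_sum_of_subset_of_nonneg ?_ ?_
        · intro h hh
          rw [Fintype.mem_piFinset]
          intro j
          exact Finset.mem_image_of_mem (fun h : Fin d → ℤ => h j) hh
        · intro h _ _
          exact Finset.prod_nonneg fun j _ => hf j _
    _ = ∏ j, ∑ h ∈ s.image (fun h => h j), f j h := (Finset.prod_univ_sum _ _).symm
    _ ≤ _ := Finset.prod_le_prod (fun j _ => Finset.sum_nonneg fun h _ => hf j h)
        fun j _ => hB j _

section kor
variable {w : ℝ} (hw : w ∈ Set.Ioo (0:ℝ) 1) {a b : ℕ → ℝ} {c K : ℝ}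
    (hapos : 0 < a 1) (ha : ∀ j : ℕ, a 1 ≤ a (j + 1))
    (hc : 0 < c) (hb : ∀ j : ℕ, c ≤ b (j + 1)) (hK0 : 0 < K)
    (hK : ∀ s : Finset ℤ, ∑ h ∈ s, w ^ (a 1 / 2 * |(h:ℝ)| ^ c) ≤ K)

include hw hapos ha hc hb in
lemma g_tail (j m : ℕ) (h : ℤ) (hm : (m:ℤ) < |h|) :
    w ^ (a (j + 1) * |(h:ℝ)| ^ b (j + 1)) ≤
      w ^ (a (j + 1) * ((m:ℝ) + 1) ^ c / 2) * w ^ (a 1 / 2 * |(h:ℝ)| ^ c) := by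
  rw [← Real.rpow_add hw.1]
  apply Real.rpow_le_rpow_of_exponent_ge hw.1 hw.2.le
  have h1 : (m:ℝ) + 1 ≤ |(h:ℝ)| := by
    have : (m:ℤ) + 1 ≤ |h| := hm
    exact_mod_cast this
  have h2 : (1:ℝ) ≤ |(h:ℝ)| := by have : (0:ℝ) ≤ m := Nat.cast_nonneg m; linarith
  have h3 : |(h:ℝ)| ^ c ≤ |(h:ℝ)| ^ b (j + 1) := Real.rpow_le_rpow_of_exponent_le h2 (hb j)
  have h4 : ((m:ℝ) + 1) ^ c ≤ |(h:ℝ)| ^ c := Real.rpow_le_rpow (by positivity) h1 hc.le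
  have h5 := ha j
  have h6 : 0 ≤ |(h:ℝ)| ^ c := by positivity
  nlinarith [mul_le_mul_of_nonneg_left h3 (hapos.le.trans h5),
    mul_le_mul_of_nonneg_left h4 (hapos.le.trans h5), mul_le_mul_of_nonneg_right h5 h6]

include hw hapos ha hc hb hK in
lemma g_tail_sum (j m : ℕ) (s : Finset ℤ) :
    ∑ h ∈ s, (if (m:ℤ) < |h| then w ^ (a (j + 1) * |(h:ℝ)| ^ b (j + 1)) else 0) ≤
      K * w ^ (a (j + 1) * ((m:ℝ) + 1) ^ c / 2) := by
  have hp := Real.rpow_nonneg hw.1.le (a (j + 1) * ((m:ℝ) + 1) ^ c / 2)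
  calc _ ≤ ∑ h ∈ s, w ^ (a (j + 1) * ((m:ℝ) + 1) ^ c / 2) * w ^ (a 1 / 2 * |(h:ℝ)| ^ c) := by
        refine Finset.sum_le_sum fun h _ => ?_
        split_ifs with hm
        · exact g_tail hw hapos ha hc hb j m h hm
        · exact mul_nonneg hp (Real.rpow_nonneg hw.1.le _)
    _ = w ^ (a (j + 1) * ((m:ℝ) + 1) ^ c / 2) * ∑ h ∈ s, w ^ (a 1 / 2 * |(h:ℝ)| ^ c) := by
        rw [Finset.mul_sum]
    _ ≤ _ := by
        rw [mul_comm]; exact mul_le_mul_of_nonneg_right (hK s) hp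

include hw hapos ha hc hb hK in
lemma g_sum (j : ℕ) (s : Finset ℤ) :
    ∑ h ∈ s, w ^ (a (j + 1) * |(h:ℝ)| ^ b (j + 1)) ≤ 1 + K * w ^ (a (j + 1) / 2) := by
  have h1 := g_tail_sum hw hapos ha hc hb hK j 0 s
  have hb0 : b (j + 1) ≠ 0 := (hc.trans_le (hb j)).ne'
  have h2 : ∀ h : ℤ, w ^ (a (j + 1) * |(h:ℝ)| ^ b (j + 1)) = (if h = 0 then 1 else 0) +
      (if ((0:ℕ):ℤ) < |h| then w ^ (a (j + 1) * |(h:ℝ)| ^ b (j + 1)) else 0) := by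
    intro h
    by_cases hh : h = 0
    · subst hh; simp [Real.zero_rpow hb0]
    · simp [hh]
  rw [Finset.sum_congr rfl (fun h _ => h2 h), Finset.sum_add_distrib]
  have h3 : ∑ h ∈ s, (if h = 0 then (1:ℝ) else 0) ≤ 1 := by
    rw [Finset.sum_ite_eq']; split_ifs <;> norm_num
  simp only [Nat.cast_zero, zero_add, Real.one_rpow, mul_one] at h1 ⊢
  linarith

/-- Product of one-dimensional sums. -/
def PP (w : ℝ) (a : ℕ → ℝ) (K : ℝ) (d : ℕ) : ℝ := ∏ j : Fin d, (1 + K * w ^ (a (j.1 + 1) / 2))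

include hw hK0 in
lemma fac_ge (j : ℕ) : 1 ≤ 1 + K * w ^ (a (j + 1) / 2) := by
  have := Real.rpow_pos_of_pos hw.1 (a (j + 1) / 2)
  have := mul_pos hK0 this
  linarith

include hw hK0 in
lemma PP_ge (d : ℕ) : 1 ≤ PP w a K d := by
  unfold PP
  exact Finset.one_le_prod (fun (j : Fin d) _ => fac_ge hw hK0 j.1)

include hw hapos ha hc hb hK in
lemma sum_bound (d : ℕ) (s : Finset (Fin d → ℤ)) :
    ∑ k ∈ s, (expKorWeight w a b d k)⁻¹ ^ 2 ≤ PP w a K d := by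
  simp only [weight_sq hw]
  exact prod_bound (fun j h => w ^ (a (j.1 + 1) * |(h:ℝ)| ^ b (j.1 + 1)))
    (fun j h => Real.rpow_nonneg hw.1.le _) _ (fun j s => g_sum hw hapos ha hc hb hK j.1 s) s

include hw hapos ha hc hb hK hK0 in
lemma tail_bound (d : ℕ) (m : Fin d → ℕ) (s : Finset (Fin d → ℤ)) :
    ∑ k ∈ s, (if ∀ j, |k j| ≤ m j then 0 else (expKorWeight w a b d k)⁻¹) ^ 2 ≤
      PP w a K d * ∑ j : Fin d, K * w ^ (a (j.1 + 1) * ((m j : ℝ) + 1) ^ c / 2) := by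
  let f : Fin d → Fin d → ℤ → ℝ := fun i j h =>
    if j = i then (if (m i:ℤ) < |h| then w ^ (a (j.1 + 1) * |(h:ℝ)| ^ b (j.1 + 1)) else 0)
      else w ^ (a (j.1 + 1) * |(h:ℝ)| ^ b (j.1 + 1))
  have hf0 : ∀ i j h, 0 ≤ f i j h := by
    intro i j h
    simp only [f]
    split_ifs <;> first | exact le_rfl | exact Real.rpow_nonneg hw.1.le _
  have h1 : ∀ k : Fin d → ℤ, (if ∀ j, |k j| ≤ m j then 0 else (expKorWeight w a b d k)⁻¹) ^ 2 ≤
      ∑ i, ∏ j, f i j (k j) := by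
    intro k
    split_ifs with hk
    · simp only [ne_eq, OfNat.ofNat_ne_zero, not_false_eq_true, zero_pow]
      exact Finset.sum_nonneg fun i _ => Finset.prod_nonneg fun j _ => hf0 i j _
    · push Not at hk
      obtain ⟨i, hi⟩ := hk
      rw [weight_sq hw]
      refine le_trans (le_of_eq ?_) (Finset.single_le_sum
        (f := fun i => ∏ j, f i j (k j)) (fun i _ => Finset.prod_nonneg fun j _ => hf0 i j _)
        (Finset.mem_univ i))
      refine Finset.prod_congr rfl fun j _ => ?_
      simp only [f]
      split_ifs with h1 h2
      · rfl
      · subst h1; exact absurd hi h2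
      · rfl
  refine (Finset.sum_le_sum fun k _ => h1 k).trans ?_
  rw [Finset.sum_comm, Finset.mul_sum]
  refine Finset.sum_le_sum fun i _ => ?_
  have hT : 0 ≤ K * w ^ (a (i.1 + 1) * ((m i : ℝ) + 1) ^ c / 2) :=
    mul_nonneg hK0.le (Real.rpow_nonneg hw.1.le _)
  refine (prod_bound (f i) (hf0 i) (fun j => if j = i then
    K * w ^ (a (i.1 + 1) * ((m i : ℝ) + 1) ^ c / 2) else 1 + K * w ^ (a (j.1 + 1) / 2))
    ?_ s).trans ?_
  · intro j s
    simp only [f]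
    by_cases hj : j = i
    · subst hj; simp only [if_true]; exact g_tail_sum hw hapos ha hc hb hK j.1 (m j) s
    · simp only [hj, if_false]; exact g_sum hw hapos ha hc hb hK j.1 s
  · unfold PP
    rw [← Finset.mul_prod_erase _ _ (Finset.mem_univ i),
      ← Finset.mul_prod_erase Finset.univ (fun j : Fin d => 1 + K * w ^ (a (j.1 + 1) / 2))
        (Finset.mem_univ i)]
    simp only [if_true]
    rw [Finset.prod_congr rfl (g := fun j : Fin d => 1 + K * w ^ (a (j.1 + 1) / 2))
      (fun j hj => by rw [if_neg (Finset.ne_of_mem_erase hj)])]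
    have hP : 0 ≤ ∏ j ∈ Finset.univ.erase i, (1 + K * w ^ (a ((j : Fin d).1 + 1) / 2)) :=
      Finset.prod_nonneg fun j _ => zero_le_one.trans (fac_ge hw hK0 j.1)
    have h7 := fac_ge (a := a) hw hK0 i.1
    nlinarith [mul_nonneg hT hP, mul_nonneg (mul_nonneg hT hP) (sub_nonneg.2 h7)]

include hw hapos ha hc hb hK hK0 in
/-- Main upper bound on the information complexity set. -/
lemma nc_upper (useStd : Bool) (crit : Crit) (d : ℕ) (ε : ℝ) (hε : 0 < ε) (B : ℝ) (hB : 0 < B)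
    (hBε : 4 * (PP w a K d * (d * (K * w ^ (B / 2)))) ≤ ε ^ 2) :
    ((2 * ⌈(B / a 1) ^ (1 / c)⌉₊ + 1) ^
      (Finset.univ.filter (fun j : Fin d => a (j.1 + 1) < B)).card : ℕ) ∈
    {n : ℕ | wcErr (expKorWeight w a b d) (if useStd then stdInfo (expKorWeight w a b d)
      else allInfo d) n ≤ ENNReal.ofReal ε * CRI (expKorWeight w a b d) crit} := by
  set M := ⌈(B / a 1) ^ (1 / c)⌉₊ with hM
  let m : Fin d → ℕ := fun j => if a (j.1 + 1) < B then M else 0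
  have hn : (2 * M + 1) ^ (Finset.univ.filter (fun j : Fin d => a (j.1 + 1) < B)).card =
      ∏ j, (2 * m j + 1) := by
    rw [← Finset.prod_const, Finset.prod_filter]
    refine Finset.prod_congr rfl fun j _ => ?_
    simp only [m]; split_ifs <;> simp
  have hS := sum_bound hw hapos ha hc hb hK d
  have hpos := weight_pos hw a b d
  have hup := wcErr_upper _ hpos _ hS m _ (tail_bound hw hapos ha hc hb hK0 hK d m)
  have hterm : ∀ j : Fin d, B ≤ a (j.1 + 1) * ((m j : ℝ) + 1) ^ c := by
    intro j
    have haj := ha j.1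
    by_cases hj : a (j.1 + 1) < B
    · have : m j = M := by simp [m, hj]
      rw [this]
      have h1 : (B / a 1) ^ (1 / c) ≤ (M:ℝ) + 1 := (Nat.le_ceil _).trans (by rw [hM]; linarith)
      have h2 : B / a 1 ≤ ((M:ℝ) + 1) ^ c := by
        calc B / a 1 = ((B / a 1) ^ (1 / c)) ^ c := by
              rw [← Real.rpow_mul (by positivity), one_div_mul_cancel hc.ne', Real.rpow_one]
          _ ≤ _ := Real.rpow_le_rpow (by positivity) h1 hc.le
      rw [div_le_iff₀ hapos] at h2
      have h3 : 0 ≤ ((M:ℝ) + 1) ^ c := by positivity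
      nlinarith
    · have : m j = 0 := by simp [m, hj]
      rw [this]; simp; linarith
  have hR : PP w a K d * ∑ j : Fin d, K * w ^ (a (j.1 + 1) * ((m j : ℝ) + 1) ^ c / 2) ≤
      (ε / 2) ^ 2 := by
    have h1 : ∑ j : Fin d, K * w ^ (a (j.1 + 1) * ((m j : ℝ) + 1) ^ c / 2) ≤
        d * (K * w ^ (B / 2)) := by
      refine (Finset.sum_le_card_nsmul _ _ (K * w ^ (B / 2)) fun j _ => ?_).trans
        (by simp)
      refine mul_le_mul_of_nonneg_left ?_ hK0.le
      apply Real.rpow_le_rpow_of_exponent_ge hw.1 hw.2.le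
      linarith [hterm j]
    have h2 := PP_ge (a := a) hw hK0 d
    nlinarith [mul_le_mul_of_nonneg_left h1 (zero_le_one.trans h2)]
  have hfin : wcErr (expKorWeight w a b d) (stdInfo (expKorWeight w a b d)) (∏ j, (2 * m j + 1)) ≤
      ENNReal.ofReal ε := by
    refine hup.trans (ENNReal.ofReal_le_ofReal ?_)
    have := Real.sqrt_le_sqrt hR
    rw [Real.sqrt_sq (by positivity)] at this
    linarith
  have h0 : expKorWeight w a b d 0 = 1 := by
    unfold expKorWeight
    have : ∀ j : Fin d, a (j.1 + 1) * |(((0 : Fin d → ℤ) j : ℤ) : ℝ)| ^ b (j.1 + 1) = 0 := by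
      intro j
      simp [Real.zero_rpow (hc.trans_le (hb j.1)).ne']
    rw [Finset.sum_congr rfl (fun j _ => this j)]; simp
  have hC : 1 ≤ CRI (expKorWeight w a b d) crit := by
    cases crit
    · exact le_rfl
    · exact one_le_initErr _ h0
  rw [hn, Set.mem_ofPred_eq]
  refine le_trans ?_ ((hfin.trans (le_of_eq (mul_one _).symm)).trans
    (mul_le_mul_right hC _))
  cases useStd
  · simpa using wcErr_anti _ (std_subset _ hpos _ hS) _
  · simp

include hw hapos ha hc hb hK hK0 in
/-- Lower bound. -/
lemma nc_lower (useStd : Bool) (crit : Crit) (d : ℕ) (ε A : ℝ) (hε : 0 < ε)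
    (hA : ∀ j : Fin d, a (j.1 + 1) ≤ A)
    (hεA : ε * (1 + K) ^ d < w ^ (d * A / 2) / 2 ^ d) :
    2 ^ d ≤ expKorNC w a b useStd crit d ε := by
  have hS := sum_bound hw hapos ha hc hb hK d
  have hpos := weight_pos hw a b d
  have hPP : PP w a K d ≤ (1 + K) ^ d := by
    unfold PP
    refine (Finset.prod_le_prod (g := fun _ => 1 + K)
      (fun (j : Fin d) _ => zero_le_one.trans (fac_ge hw hK0 j.1)) fun j _ => ?_).trans (by simp)
    have : w ^ (a (j.1 + 1) / 2) ≤ 1 := Real.rpow_le_one hw.1.le hw.2.le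
      (by have := ha j.1; linarith)
    nlinarith
  have hPP1 := PP_ge (a := a) hw hK0 d
  have hC : CRI (expKorWeight w a b d) crit ≤ ENNReal.ofReal ((1 + K) ^ d) := by
    cases crit
    · simp only [CRI]; rw [← ENNReal.ofReal_one]
      exact ENNReal.ofReal_le_ofReal (hPP1.trans hPP)
    · refine (initErr_le _ hpos _ hS).trans (ENNReal.ofReal_le_ofReal ?_)
      refine le_trans ?_ hPP
      rw [Real.sqrt_le_left (by linarith)]
      nlinarith
  have hne : {n : ℕ | wcErr (expKorWeight w a b d) (if useStd then stdInfo (expKorWeight w a b d)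
      else allInfo d) n ≤ ENNReal.ofReal ε * CRI (expKorWeight w a b d) crit}.Nonempty := by
    have ht : Tendsto (fun B : ℝ => 4 * (PP w a K d * (d * (K * w ^ (B / 2))))) atTop
        (nhds (4 * (PP w a K d * (d * (K * 0))))) := by
      have h1 : Tendsto (fun B : ℝ => w ^ (B / 2)) atTop (nhds 0) :=
        (tendsto_rpow_atTop_of_base_lt_one w (by linarith [hw.1]) hw.2).comp
          (tendsto_id.atTop_div_const two_pos)
      exact (((h1.const_mul K).const_mul _).const_mul _).const_mul _
    simp only [mul_zero] at ht
    obtain ⟨B, hB1, hB2⟩ := ((ht.eventually_le_const (u := ε ^ 2) (by positivity)).and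
      (eventually_gt_atTop 0)).exists
    exact ⟨_, nc_upper hw hapos ha hc hb hK0 hK useStd crit d ε hε B hB2 hB1⟩
  unfold expKorNC infoComp
  by_contra! hlt
  have hmem := Nat.sInf_mem hne
  rw [Set.mem_ofPred_eq] at hmem
  set n := sInf {n : ℕ | wcErr (expKorWeight w a b d) (if useStd then
      stdInfo (expKorWeight w a b d)
      else allInfo d) n ≤ ENNReal.ofReal ε * CRI (expKorWeight w a b d) crit}
  have hlow := wcErr_lower _ hpos _ hS n hlt (w ^ (d * A / 2)) (by
    intro q
    unfold expKorWeight
    rw [← Real.rpow_neg hw.1.le]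
    apply Real.rpow_le_rpow_of_exponent_ge hw.1 hw.2.le
    have : ∑ j : Fin d, a (j.1 + 1) * |((zv q j : ℤ) : ℝ)| ^ b (j.1 + 1) ≤ d * A := by
      refine (Finset.sum_le_card_nsmul _ _ A fun j _ => ?_).trans (by simp)
      have h1 : |((zv q j : ℤ) : ℝ)| ^ b (j.1 + 1) ≤ 1 := by
        apply Real.rpow_le_one (abs_nonneg _) _ (hc.le.trans (hb j.1))
        have := (q j).2
        have h2 : ((q j : ℕ) : ℝ) ≤ 1 := by exact_mod_cast (by omega : (q j : ℕ) ≤ 1)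
        simpa [zv] using h2
      have h3 := ha j.1
      have h4 := hA j
      nlinarith
    linarith)
  have h1 : wcErr (expKorWeight w a b d) (allInfo d) n ≤ ENNReal.ofReal (ε * (1 + K) ^ d) := by
    rw [ENNReal.ofReal_mul hε.le]
    refine le_trans ?_ (hmem.trans (mul_le_mul_right hC _))
    cases useStd
    · simp
    · simpa using wcErr_anti _ (std_subset _ hpos _ hS) _
  have h2 := hlow.trans h1
  rw [ENNReal.ofReal_le_ofReal_iff (by positivity)] at h2
  linarith

end kor

lemma a_growth {a : ℕ → ℝ} (hap : ∀ j, 1 ≤ j → 0 < a j)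
    (h : Tendsto (fun j : ℕ => Real.log (a j) / Real.log j) atTop atTop) (r : ℝ) :
    ∃ J : ℕ, ∀ j, J ≤ j → (j:ℝ) ^ r ≤ a j := by
  obtain ⟨J, hJ⟩ := eventually_atTop.1 (h.eventually_ge_atTop r)
  refine ⟨max J 2, fun j hj => ?_⟩
  have h1 := hJ j ((le_max_left _ _).trans hj)
  have h2 : 2 ≤ j := (le_max_right _ _).trans hj
  have hj0 : (0:ℝ) < j := by exact_mod_cast (by omega : 0 < j)
  have hl : 0 < Real.log j := Real.log_pos (by exact_mod_cast (by omega : 1 < j))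
  rw [le_div_iff₀ hl] at h1
  rw [← Real.log_le_log_iff (Real.rpow_pos_of_pos hj0 r) (hap j (by omega)), Real.log_rpow hj0]
  exact h1

lemma PP_bdd {w : ℝ} (hw : w ∈ Set.Ioo (0:ℝ) 1) {a : ℕ → ℝ} (hap : ∀ j, 1 ≤ j → 0 < a j)
    {K : ℝ} (hK0 : 0 < K)
    (h : Tendsto (fun j : ℕ => Real.log (a j) / Real.log j) atTop atTop) :
    ∃ P0 > (0:ℝ), ∀ d, PP w a K d ≤ P0 := by
  obtain ⟨J, hJ⟩ := a_growth hap h 1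
  have hs : Summable (fun j : ℕ => w ^ (a (j + 1) / 2)) := by
    have hr0 : 0 ≤ w ^ ((1:ℝ)/2) := Real.rpow_nonneg hw.1.le _
    have hr1 : w ^ ((1:ℝ)/2) < 1 := Real.rpow_lt_one hw.1.le hw.2 (by norm_num)
    have hg := summable_geometric_of_lt_one hr0 hr1
    refine Summable.of_norm_bounded_eventually_nat hg ?_
    filter_upwards [eventually_ge_atTop J] with j hj
    rw [Real.norm_of_nonneg (Real.rpow_nonneg hw.1.le _), ← Real.rpow_natCast,
      ← Real.rpow_mul hw.1.le]
    apply Real.rpow_le_rpow_of_exponent_ge hw.1 hw.2.le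
    have := hJ (j + 1) (by omega)
    rw [Real.rpow_one] at this
    push_cast at this
    linarith
  refine ⟨Real.exp (K * ∑' j : ℕ, w ^ (a (j + 1) / 2)), Real.exp_pos _, fun d => ?_⟩
  unfold PP
  calc _ ≤ ∏ j : Fin d, Real.exp (K * w ^ (a (j.1 + 1) / 2)) := by
        refine Finset.prod_le_prod (fun j _ => zero_le_one.trans (fac_ge hw hK0 j.1)) fun j _ => ?_
        rw [add_comm]; exact Real.add_one_le_exp _
    _ = Real.exp (K * ∑ j : Fin d, w ^ (a (j.1 + 1) / 2)) := by
        rw [← Real.exp_sum, Finset.mul_sum]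
    _ ≤ _ := by
        rw [Fin.sum_univ_eq_sum_range (fun j => w ^ (a (j + 1) / 2))]
        apply Real.exp_le_exp.2
        exact mul_le_mul_of_nonneg_left
          (hs.sum_le_tsum _ (fun j _ => Real.rpow_nonneg hw.1.le _)) hK0.le

lemma count_bdd {a : ℕ → ℝ} (hap : ∀ j, 1 ≤ j → 0 < a j)
    (h : Tendsto (fun j : ℕ => Real.log (a j) / Real.log j) atTop atTop) (s : ℝ) (hs : 0 < s) :
    ∃ J : ℕ, ∀ (d : ℕ) (B : ℝ), 1 ≤ B →
      ((Finset.univ.filter (fun j : Fin d => a (j.1 + 1) < B)).card : ℝ) ≤ J + B ^ s := by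
  obtain ⟨J, hJ⟩ := a_growth hap h (1 / s)
  refine ⟨J, fun d B hB => ?_⟩
  have hBs : 0 ≤ B ^ s := Real.rpow_nonneg (by linarith) _
  have h1 : (Finset.univ.filter (fun j : Fin d => a (j.1 + 1) < B)).card ≤
      (Finset.range ⌊(J:ℝ) + B ^ s⌋₊).card := by
    refine Finset.card_le_card_of_injOn (fun j => j.1) ?_ (fun x _ y _ hxy => Fin.ext hxy)
    intro j hj
    simp only [Finset.coe_filter, Finset.mem_univ, true_and] at hj
    have hj' : a (j.1 + 1) < B := hj
    simp only [Finset.coe_range, Set.mem_Iio]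
    rw [← Nat.succ_le_iff]
    apply Nat.le_floor
    by_cases hjJ : J ≤ j.1 + 1
    · have h2 := (hJ _ hjJ).trans hj'.le
      have h3 := Real.rpow_le_rpow (by positivity) h2 hs.le
      rw [← Real.rpow_mul (by positivity), one_div_mul_cancel hs.ne', Real.rpow_one] at h3
      have : (0:ℝ) ≤ J := Nat.cast_nonneg _
      push_cast at h3 ⊢; linarith
    · have : ((j.1 + 1 : ℕ) : ℝ) ≤ J := by exact_mod_cast (by omega : j.1 + 1 ≤ J)
      push_cast at this ⊢; linarith
  rw [Finset.card_range] at h1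
  calc _ ≤ ((⌊(J:ℝ) + B ^ s⌋₊ : ℕ) : ℝ) := by exact_mod_cast h1
    _ ≤ _ := Nat.floor_le (by positivity)

lemma log_base_bdd (A c s : ℝ) (hA : 0 < A) (hc : 0 < c) (hs : 0 < s) :
    ∃ C > (0:ℝ), ∀ B : ℝ, 1 ≤ B →
      Real.log ((2 * ⌈(B / A) ^ (1 / c)⌉₊ + 1 : ℕ) : ℝ) ≤ C * B ^ s := by
  set C1 : ℝ := 3 + 2 * (1 / A) ^ (1 / c) with hC1
  have hq : 0 < (1 / A) ^ (1 / c) := by positivity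
  have hlC : 0 < Real.log C1 := Real.log_pos (by linarith)
  refine ⟨Real.log C1 + (1 / c) / s, by positivity, fun B hB => ?_⟩
  have hB0 : 0 < B := by linarith
  have h1 : ((2 * ⌈(B / A) ^ (1 / c)⌉₊ + 1 : ℕ) : ℝ) ≤ C1 * B ^ (1 / c) := by
    have h2 := (Nat.ceil_lt_add_one (a := (B / A) ^ (1 / c)) (by positivity)).le
    have h3 : (B / A) ^ (1 / c) = (1 / A) ^ (1 / c) * B ^ (1 / c) := by
      rw [← Real.mul_rpow (by positivity) (by positivity)]; congr 1; ring
    have h4 : 1 ≤ B ^ (1 / c) := Real.one_le_rpow hB (by positivity)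
    rw [h3] at h2 ⊢
    push_cast
    rw [hC1]; nlinarith
  have h5 : 1 ≤ B ^ s := Real.one_le_rpow hB hs.le
  have h6 := Real.log_le_rpow_div hB0.le hs
  calc _ ≤ Real.log (C1 * B ^ (1 / c)) := Real.log_le_log (by positivity) h1
    _ = Real.log C1 + (1 / c) * Real.log B := by
        rw [Real.log_mul (by positivity) (by positivity), Real.log_rpow hB0]
    _ ≤ Real.log C1 * B ^ s + (1 / c) * (B ^ s / s) := by
        gcongr
        nlinarith
    _ = _ := by ring

lemma y_large (α β : ℝ) (hα : 0 < α) (hβ : 0 < β) (Y : ℝ) : ∃ M : ℝ, ∀ d : ℕ, 0 < d →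
    ∀ ε ∈ Set.Ioo (0:ℝ) 1, M ≤ ε⁻¹ + d → Y < (1 + Real.log ε⁻¹) ^ α + (d:ℝ) ^ β := by
  have h1 : Tendsto (fun t : ℝ => (1 + Real.log t) ^ α) atTop atTop :=
    (tendsto_rpow_atTop hα).comp (tendsto_atTop_add_const_left _ _ Real.tendsto_log_atTop)
  have h2 := tendsto_rpow_atTop hβ
  obtain ⟨T, hT⟩ := eventually_atTop.1 ((h1.eventually_gt_atTop Y).and (h2.eventually_gt_atTop Y))
  refine ⟨2 * T, fun d hd ε hε hM => ?_⟩
  have hl : 0 ≤ Real.log ε⁻¹ := Real.log_nonneg ((one_le_inv₀ hε.1).2 hε.2.le)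
  have p1 : 0 ≤ (1 + Real.log ε⁻¹) ^ α := by positivity
  have p2 : 0 ≤ (d:ℝ) ^ β := by positivity
  rcases le_total T ε⁻¹ with h | h
  · have := (hT _ h).1; linarith
  · have := (hT d (by linarith)).2; linarith

set_option maxHeartbeats 1000000 in
theorem upper_dir
    (w : ℝ) (hw : w ∈ Set.Ioo (0:ℝ) 1) (a b : ℕ → ℝ) (c K : ℝ)
    (hapos : 0 < a 1) (ha : ∀ j : ℕ, a 1 ≤ a (j + 1))
    (hc : 0 < c) (hb : ∀ j : ℕ, c ≤ b (j + 1)) (hK0 : 0 < K)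
    (hK : ∀ s : Finset ℤ, ∑ h ∈ s, w ^ (a 1 / 2 * |(h:ℝ)| ^ c) ≤ K)
    (crit : Crit) (useStd : Bool)
    (h : Tendsto (fun j : ℕ => Real.log (a j) / Real.log j) atTop atTop) :
    EXPUWT (expKorNC w a b useStd crit) := by
  intro α hα β hβ δ hδ
  have hap : ∀ j, 1 ≤ j → 0 < a j := by
    intro j hj
    obtain ⟨i, rfl⟩ := Nat.exists_eq_add_of_le' hj
    exact hapos.trans_le (ha i)
  obtain ⟨P0, hP0, hPP⟩ := PP_bdd hw hap hK0 h
  have hs : 0 < α / 4 := by positivity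
  obtain ⟨J, hJ⟩ := count_bdd hap h (α / 4) hs
  obtain ⟨C2, hC2, hlog⟩ := log_base_bdd (a 1) c (α / 4) hapos hc hs
  have hL : 0 < -Real.log w := by have := Real.log_neg hw.1 hw.2; linarith
  set L := -Real.log w with hLdef
  set Q : ℝ := 4 * P0 * K + 1 with hQ
  have hQ1 : 1 ≤ Q := by have : 0 < P0 * K := by positivity
                         rw [hQ]; linarith
  have hlQ : 0 ≤ Real.log Q := Real.log_nonneg hQ1
  set C4 : ℝ := 2 / L * (Real.log Q + 2) + 1 with hC4
  have hC4p : 0 < C4 := by positivity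
  set C5 : ℝ := 1 + α / β with hC5
  have hC5p : 0 < C5 := by positivity
  set C6 : ℝ := (J + 1) * C2 * (C4 * C5) ^ (α / 2) with hC6
  have hC6p : 0 < C6 := by positivity
  obtain ⟨M, hM⟩ := y_large α β hα hβ ((C6 / δ) ^ 2)
  refine ⟨M, fun d hd ε hε hMd => ?_⟩
  have hy := hM d hd ε hε hMd
  set x : ℝ := 1 + Real.log ε⁻¹ with hx
  set y : ℝ := x ^ α + (d:ℝ) ^ β with hydef
  have hd1 : (1:ℝ) ≤ d := by exact_mod_cast hd
  have hle : 0 ≤ Real.log ε⁻¹ := Real.log_nonneg ((one_le_inv₀ hε.1).2 hε.2.le)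
  have hld : 0 ≤ Real.log d := Real.log_nonneg hd1
  have hx1 : 1 ≤ x := by rw [hx]; linarith
  have hy0 : 0 < y := by positivity
  set B : ℝ := 2 / L * (Real.log Q + Real.log d + 2 * Real.log ε⁻¹) + 1 with hB
  have hB1 : 1 ≤ B := by
    have : 0 ≤ 2 / L * (Real.log Q + Real.log d + 2 * Real.log ε⁻¹) := by positivity
    rw [hB]; linarith
  have hB0 : 0 < B := by linarith
  have hBle : B ≤ C4 * (x + Real.log d) := by
    have h2L : 0 < 2 / L := by positivity
    have e1 : Real.log Q + Real.log d + 2 * Real.log ε⁻¹ ≤ (Real.log Q + 2) * (x + Real.log d) := by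
      rw [hx]; nlinarith [mul_nonneg hlQ hle, mul_nonneg hlQ hld]
    have e2 := mul_le_mul_of_nonneg_left e1 h2L.le
    rw [hB, hC4]; nlinarith
  have hBw : w ^ (B / 2) ≤ ε ^ 2 / (Q * d) := by
    have e0 : ε ^ 2 / (Q * d) = Real.exp (-(Real.log Q + Real.log d + 2 * Real.log ε⁻¹)) := by
      have : Real.log (ε ^ 2 / (Q * d)) = -(Real.log Q + Real.log d + 2 * Real.log ε⁻¹) := by
        rw [Real.log_div (by have := hε.1; positivity) (by positivity), Real.log_pow,
          Real.log_mul (by positivity) (by positivity), Real.log_inv]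
        push_cast; ring
      rw [← this, Real.exp_log (by have := hε.1; positivity)]
    rw [e0, Real.rpow_def_of_pos hw.1]
    apply Real.exp_le_exp.2
    have e3 : L * (B / 2) = Real.log Q + Real.log d + 2 * Real.log ε⁻¹ + L / 2 := by
      rw [hB]; field_simp
    have e4 : Real.log w * (B / 2) = -(L * (B / 2)) := by rw [hLdef]; ring
    rw [e4, e3]; linarith
  have hBε : 4 * (PP w a K d * (d * (K * w ^ (B / 2)))) ≤ ε ^ 2 := by
    have hwB : 0 ≤ w ^ (B / 2) := Real.rpow_nonneg hw.1.le _
    calc 4 * (PP w a K d * (d * (K * w ^ (B / 2)))) ≤ 4 * (P0 * (d * (K * (ε ^ 2 / (Q * d))))) := by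
          have := hPP d
          gcongr
      _ = (4 * P0 * K) * ε ^ 2 / Q := by field_simp
      _ ≤ ε ^ 2 := by
          rw [div_le_iff₀ (by positivity), mul_comm (ε ^ 2)]
          apply mul_le_mul_of_nonneg_right _ (by positivity)
          rw [hQ]; linarith
  have hmem := nc_upper hw hapos ha hc hb hK0 hK useStd crit d ε hε.1 B hB0 hBε
  have hnc : expKorNC w a b useStd crit d ε ≤ _ := Nat.sInf_le hmem
  set N := expKorNC w a b useStd crit d ε with hN
  have hlogN0 : 0 ≤ Real.log (N:ℝ) := Real.log_natCast_nonneg N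
  have hlogN : Real.log (N:ℝ) ≤ (J + 1) * C2 * B ^ (α / 2) := by
    have hBs : 1 ≤ B ^ (α / 4) := Real.one_le_rpow hB1 hs.le
    set k := (Finset.univ.filter (fun j : Fin d => a (j.1 + 1) < B)).card with hk
    have e1 : Real.log (N:ℝ) ≤ k * Real.log ((2 * ⌈(B / a 1) ^ (1 / c)⌉₊ + 1 : ℕ) : ℝ) := by
      rw [← Real.log_pow]
      rcases Nat.eq_zero_or_pos N with h0 | h0
      · rw [h0]; simp only [Nat.cast_zero, Real.log_zero]
        apply Real.log_nonneg
        apply one_le_pow₀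
        exact_mod_cast Nat.succ_le_succ (Nat.zero_le _)
      · apply Real.log_le_log (by exact_mod_cast h0)
        exact_mod_cast hnc
    have e2 := hlog B hB1
    have e3 := hJ d B hB1
    have e4 : B ^ (α / 2) = B ^ (α / 4) * B ^ (α / 4) := by
      rw [← Real.rpow_add hB0]; congr 1; ring
    have e5 : (k:ℝ) ≤ (J + 1) * B ^ (α / 4) := by
      have e6 : (0:ℝ) ≤ J := Nat.cast_nonneg _
      have e7 := mul_le_mul_of_nonneg_left hBs e6
      linarith
    calc _ ≤ _ := e1
      _ ≤ ((J + 1) * B ^ (α / 4)) * (C2 * B ^ (α / 4)) := by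
          apply mul_le_mul e5 e2 (Real.log_natCast_nonneg _) (by positivity)
      _ = _ := by rw [e4]; ring
  have hxy : x + Real.log d ≤ C5 * y ^ (1 / α) := by
    have f1 : x ≤ y ^ (1 / α) := by
      calc x = (x ^ α) ^ (1 / α) := by
            rw [← Real.rpow_mul (by linarith), mul_one_div_cancel hα.ne', Real.rpow_one]
        _ ≤ _ := by
            apply Real.rpow_le_rpow (by positivity) _ (by positivity)
            have : 0 ≤ (d:ℝ) ^ β := by positivity
            rw [hydef]; linarith
    have f2 : Real.log d ≤ (α / β) * y ^ (1 / α) := by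
      have := Real.log_le_rpow_div (x := d) (by positivity) (div_pos hβ hα)
      have f3 : (d:ℝ) ^ (β / α) ≤ y ^ (1 / α) := by
        calc (d:ℝ) ^ (β / α) = ((d:ℝ) ^ β) ^ (1 / α) := by
              rw [← Real.rpow_mul (by positivity)]; congr 1; ring
          _ ≤ _ := by
              apply Real.rpow_le_rpow (by positivity) _ (by positivity)
              have : 0 ≤ x ^ α := by positivity
              rw [hydef]; linarith
      calc _ ≤ _ := this
        _ = (α / β) * (d:ℝ) ^ (β / α) := by field_simp
        _ ≤ _ := by gcongr
    rw [hC5]; linarith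
  have hBy : B ^ (α / 2) ≤ (C4 * C5) ^ (α / 2) * √y := by
    calc B ^ (α / 2) ≤ (C4 * C5 * y ^ (1 / α)) ^ (α / 2) := by
          apply Real.rpow_le_rpow hB0.le _ (by positivity)
          calc _ ≤ _ := hBle
            _ ≤ C4 * (C5 * y ^ (1 / α)) := by gcongr
            _ = _ := by ring
      _ = _ := by
          rw [Real.mul_rpow (by positivity) (by positivity), ← Real.rpow_mul hy0.le,
            Real.sqrt_eq_rpow]
          congr 2; field_simp
  have hfin : Real.log (N:ℝ) ≤ C6 * √y := by
    calc _ ≤ _ := hlogN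
      _ ≤ (J + 1) * C2 * ((C4 * C5) ^ (α / 2) * √y) := by gcongr
      _ = _ := by rw [hC6]; ring
  have hsy : C6 / δ < √y := Real.lt_sqrt_of_sq_lt hy
  rw [abs_of_nonneg (div_nonneg hlogN0 hy0.le), div_lt_iff₀ hy0]
  rw [div_lt_iff₀ hδ] at hsy
  have hsp : 0 < √y := Real.sqrt_pos.2 hy0
  calc _ ≤ _ := hfin
    _ < √y * δ * √y := by gcongr
    _ = δ * (√y * √y) := by ring
    _ = δ * y := by rw [Real.mul_self_sqrt hy0.le]

set_option maxHeartbeats 1000000 in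
theorem lower_dir
    (w : ℝ) (hw : w ∈ Set.Ioo (0:ℝ) 1) (a b : ℕ → ℝ) (c K : ℝ)
    (hapos : 0 < a 1) (ha : ∀ j : ℕ, a 1 ≤ a (j + 1))
    (hmono : ∀ i j, 1 ≤ i → i ≤ j → a i ≤ a j)
    (hc : 0 < c) (hb : ∀ j : ℕ, c ≤ b (j + 1)) (hK0 : 0 < K)
    (hK : ∀ s : Finset ℤ, ∑ h ∈ s, w ^ (a 1 / 2 * |(h:ℝ)| ^ c) ≤ K)
    (crit : Crit) (useStd : Bool)
    (hE : EXPUWT (expKorNC w a b useStd crit)) :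
    Tendsto (fun j : ℕ => Real.log (a j) / Real.log j) atTop atTop := by
  by_contra hcon
  rw [tendsto_atTop] at hcon
  push Not at hcon
  obtain ⟨M0, hM0⟩ := hcon
  have hL : 0 < -Real.log w := by have := Real.log_neg hw.1 hw.2; linarith
  set L := -Real.log w with hLdef
  set p : ℝ := max M0 1 with hp
  have hp1 : 1 ≤ p := le_max_right _ _
  have hl2 : 0 < Real.log 2 := Real.log_pos (by norm_num)
  have hlK : 0 < Real.log (2 * (1 + K)) := Real.log_pos (by linarith)
  set C7 : ℝ := 1 + L / 2 + Real.log (2 * (1 + K)) + Real.log 2 with hC7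
  have hC7p : 0 < C7 := by positivity
  set α : ℝ := 1 / (2 * (p + 1)) with hα
  have hαp : 0 < α := by positivity
  set D : ℝ := C7 ^ α + 1 with hD
  have hDp : 0 < D := by positivity
  obtain ⟨M, hM⟩ := hE α hαp (1 / 2) (by norm_num) (Real.log 2 / D) (by positivity)
  obtain ⟨d, hd1, hd2⟩ := (hM0.and_eventually (eventually_ge_atTop (max ⌈M⌉₊ 2))).exists
  have hd2' : 2 ≤ d := (le_max_right _ _).trans hd2
  have hdM : M ≤ d := (Nat.le_ceil M).trans (by exact_mod_cast (le_max_left _ _).trans hd2)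
  have hdr : (2:ℝ) ≤ d := by exact_mod_cast hd2'
  have hd0 : (0:ℝ) < d := by linarith
  have had : a d ≤ (d:ℝ) ^ p := by
    have hld : 0 < Real.log d := Real.log_pos (by linarith)
    have hlt : Real.log (a d) / Real.log d < M0 := by simpa using hd1
    rw [div_lt_iff₀ hld] at hlt
    have had0 : 0 < a d := hapos.trans_le (hmono 1 d le_rfl (by omega))
    rw [← Real.log_le_log_iff had0 (by positivity), Real.log_rpow hd0]
    have : M0 ≤ p := le_max_left _ _
    nlinarith
  set ε : ℝ := w ^ (d * (d:ℝ) ^ p / 2) / (2 * (2 * (1 + K)) ^ d) with hε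
  have hwp : 0 < w ^ (d * (d:ℝ) ^ p / 2) := Real.rpow_pos_of_pos hw.1 _
  have hε0 : 0 < ε := by positivity
  have hKd : 1 ≤ (2 * (1 + K)) ^ d := one_le_pow₀ (by linarith)
  have hε1 : ε < 1 := by
    rw [hε, div_lt_one (by positivity)]
    have : w ^ (d * (d:ℝ) ^ p / 2) ≤ 1 := Real.rpow_le_one hw.1.le hw.2.le (by positivity)
    linarith
  have hlow := nc_lower hw hapos ha hc hb hK0 hK useStd crit d ε ((d:ℝ) ^ p) hε0
    (fun j => (hmono _ _ (by omega) (by have := j.2; omega)).trans had) (by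
      have : ε * (1 + K) ^ d = w ^ (d * (d:ℝ) ^ p / 2) / 2 ^ d / 2 := by
        rw [hε, mul_pow]; field_simp
      rw [this]
      have : 0 < w ^ (d * (d:ℝ) ^ p / 2) / 2 ^ d := by positivity
      linarith)
  have hε' := hM d (by omega) ε ⟨hε0, hε1⟩ (by have := inv_pos.2 hε0; linarith)
  set N := expKorNC w a b useStd crit d ε with hN
  have hlogN : d * Real.log 2 ≤ Real.log (N:ℝ) := by
    rw [← Real.log_pow]
    apply Real.log_le_log (by positivity)
    exact_mod_cast hlow
  have hdp : (d:ℝ) * (d:ℝ) ^ p = (d:ℝ) ^ (p + 1) := by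
    rw [Real.rpow_add hd0, Real.rpow_one]; ring
  have hlε : 1 + Real.log ε⁻¹ ≤ C7 * (d:ℝ) ^ (p + 1) := by
    have e1 : Real.log ε⁻¹ = (d:ℝ) ^ (p + 1) * (L / 2) + d * Real.log (2 * (1 + K)) + Real.log 2 := by
      rw [Real.log_inv, hε, Real.log_div hwp.ne' (by positivity),
        Real.log_mul (by norm_num) (by positivity), Real.log_pow, Real.log_rpow hw.1, hdp, hLdef]
      ring
    have e2 : 1 ≤ (d:ℝ) ^ (p + 1) := Real.one_le_rpow (by linarith) (by linarith)
    have e3 : (d:ℝ) ≤ (d:ℝ) ^ (p + 1) := by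
      calc (d:ℝ) = (d:ℝ) ^ (1:ℝ) := (Real.rpow_one _).symm
        _ ≤ _ := Real.rpow_le_rpow_of_exponent_le (by linarith) (by linarith)
    rw [e1, hC7]; nlinarith
  have hlε0 : 0 ≤ Real.log ε⁻¹ := Real.log_nonneg ((one_le_inv₀ hε0).2 hε1.le)
  have hden : (1 + Real.log ε⁻¹) ^ α + (d:ℝ) ^ ((1:ℝ) / 2) ≤ D * √d := by
    have e1 : (1 + Real.log ε⁻¹) ^ α ≤ C7 ^ α * √d := by
      calc _ ≤ (C7 * (d:ℝ) ^ (p + 1)) ^ α := Real.rpow_le_rpow (by linarith) hlε hαp.le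
        _ = _ := by
          rw [Real.mul_rpow hC7p.le (by positivity), ← Real.rpow_mul hd0.le, Real.sqrt_eq_rpow]
          congr 2; rw [hα]; field_simp
    rw [← Real.sqrt_eq_rpow, hD]; linarith
  have hden0 : 0 < (1 + Real.log ε⁻¹) ^ α + (d:ℝ) ^ ((1:ℝ) / 2) := by positivity
  have h1 := lt_of_abs_lt hε'
  rw [div_lt_iff₀ hden0] at h1
  have h2 : Real.log 2 / D * ((1 + Real.log ε⁻¹) ^ α + (d:ℝ) ^ ((1:ℝ) / 2)) ≤
      Real.log 2 * √d := by
    calc _ ≤ Real.log 2 / D * (D * √d) := by gcongr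
      _ = _ := by field_simp
  have h3 : √(d:ℝ) ≤ d := by
    rw [Real.sqrt_le_left hd0.le]; nlinarith
  nlinarith

/-- For the Korobov spaces with exponential weight, for either
information class and either error criterion, EXP-UWT ⟺ `lim_j ln a_j / ln j = ∞`. -/
theorem stmt18
    (w : ℝ) (hw : w ∈ Set.Ioo (0:ℝ) 1)
    (a b : ℕ → ℝ)
    (hapos : 0 < a 1) (hamono : ∀ j, 1 ≤ j → a j ≤ a (j + 1))
    (hb : ∃ c > (0:ℝ), ∀ j, 1 ≤ j → c ≤ b j)
    (crit : Crit) (useStd : Bool) :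
    EXPUWT (expKorNC w a b useStd crit) ↔
      Filter.Tendsto (fun j : ℕ => Real.log (a j) / Real.log j)
        Filter.atTop Filter.atTop := by
  obtain ⟨c, hc, hbc⟩ := hb
  have hmono : ∀ i j, 1 ≤ i → i ≤ j → a i ≤ a j := by
    intro i j hi hij
    induction j, hij using Nat.le_induction with
    | base => exact le_rfl
    | succ n hn ih => exact ih.trans (hamono n (hi.trans hn))
  have ha : ∀ j : ℕ, a 1 ≤ a (j + 1) := fun j => hmono 1 (j + 1) le_rfl (by omega)
  have hb' : ∀ j : ℕ, c ≤ b (j + 1) := fun j => hbc (j + 1) (by omega)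
  obtain ⟨K, hK0, hK⟩ := exists_K w hw (a 1 / 2) c (by positivity) hc
  exact ⟨lower_dir w hw a b c K hapos ha hmono hc hb' hK0 hK crit useStd,
    upper_dir w hw a b c K hapos ha hc hb' hK0 hK crit useStd⟩
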